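/- In a 0-simple countably compact topological inverse semigroup, the zero element is an isolated point of the underlying topological space. -/

import Mathlib

/-- A topological space is countably compact if every countable open cover
has a finite subcover. -/
def CountablyCompact (X : Type*) [TopologicalSpace X] : Prop :=
  ∀ U : ℕ → Set X, (∀ n, IsOpen (U n)) → (⋃ n, U n) = Set.univ →
    ∃ t : Finset ℕ, (⋃ n ∈ t, U n) = Set.univ

open Filter Topology

theorem cc_cluster {S : Type*} [TopologicalSpace S] (hcc : CountablyCompact S) (u : ℕ → S) :
    ∃ c : S, ∃ F : Filter ℕ, F.NeBot ∧ F ≤ atTop ∧ Tendsto u F (𝓝 c) := by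
  by_cases H : ∃ c, MapClusterPt c atTop u
  · obtain ⟨c, hc⟩ := H
    refine ⟨c, atTop ⊓ comap u (𝓝 c), ?_, inf_le_left, ?_⟩
    · rw [← map_neBot_iff u, Filter.push_pull, inf_comm]
      exact hc
    · exact tendsto_comap.mono_left inf_le_right
  · exfalso
    push Not at H
    obtain ⟨t, ht⟩ := hcc (fun n => (closure (u '' Set.Ici n))ᶜ)
      (fun n => isClosed_closure.isOpen_compl) (by
        rw [Set.eq_univ_iff_forall]
        intro c
        by_contra hc
        apply H c
        rw [mapClusterPt_iff_frequently]
        intro s hs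
        rw [frequently_atTop]
        intro n
        simp only [Set.mem_iUnion, Set.mem_compl_iff, not_exists, not_not] at hc
        obtain ⟨y, hy, k, hk, rfl⟩ := mem_closure_iff_nhds.1 (hc n) s hs
        exact ⟨k, hk, hy⟩)
    have : u (t.sup id) ∈ ⋃ n ∈ t, (closure (u '' Set.Ici n))ᶜ := by rw [ht]; trivial
    simp only [Set.mem_iUnion] at this
    obtain ⟨n, hn, h⟩ := this
    exact h (subset_closure ⟨_, Finset.le_sup (f := id) hn, rfl⟩)

theorem inv_unique_aux {S : Type*} [Semigroup S] (inv : S → S)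
    (hinv1 : ∀ a : S, a * inv a * a = a)
    (hinv2 : ∀ a : S, inv a * a * inv a = inv a)
    (hidem : ∀ e f : S, e * e = e → f * f = f → e * f = f * e)
    (x y : S) (h1 : x * y * x = x) (h2 : y * x * y = y) : inv x = y := by
  have i1 : (x * y) * (x * y) = x * y := by rw [← mul_assoc, h1]
  have i2 : (x * inv x) * (x * inv x) = x * inv x := by rw [← mul_assoc, hinv1]
  have i3 : (y * x) * (y * x) = y * x := by rw [← mul_assoc, h2]
  have i4 : (inv x * x) * (inv x * x) = inv x * x := by rw [← mul_assoc, hinv2]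
  have c1 := hidem _ _ i1 i2
  rw [← mul_assoc, h1, ← mul_assoc, hinv1] at c1
  have c2 := hidem _ _ i3 i4
  have e1 : y * x * (inv x * x) = y * x := by
    rw [mul_assoc, ← mul_assoc x, hinv1]
  have e2 : inv x * x * (y * x) = inv x * x := by
    rw [mul_assoc, ← mul_assoc x, h1]
  rw [e1, e2] at c2
  rw [← hinv2 x, ← c2, mul_assoc, c1, ← mul_assoc, h2]

theorem no_bicyclic {S : Type*} [Semigroup S] [TopologicalSpace S] [T2Space S]
    (inv : S → S)
    (hinv1 : ∀ a : S, a * inv a * a = a)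
    (hinv2 : ∀ a : S, inv a * a * inv a = inv a)
    (hidem : ∀ e f : S, e * e = e → f * f = f → e * f = f * e)
    (hmulc : Continuous fun p : S × S => p.1 * p.2)
    (hinvc : Continuous inv)
    (hcc : CountablyCompact S) (a b e : S) (hab : a * b = e) (hea : e * a = a)
    (hae : a * e = a) (heb : e * b = b) (hbe : b * e = b) (hee : e * e = e) : b * a = e := by
  have T : ∀ {F : Filter ℕ} {u v : ℕ → S} {x y : S}, Tendsto u F (𝓝 x) → Tendsto v F (𝓝 y) →
      Tendsto (fun n => u n * v n) F (𝓝 (x * y)) := by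
    intro F u v x y hu hv
    exact (hmulc.tendsto (x, y)).comp (hu.prodMk_nhds hv)
  let A : ℕ → S := fun n => Nat.rec e (fun _ r => r * a) n
  let B : ℕ → S := fun n => Nat.rec e (fun _ r => b * r) n
  have A0 : A 0 = e := rfl
  have B0 : B 0 = e := rfl
  have As : ∀ n, A (n+1) = A n * a := fun _ => rfl
  have Bs : ∀ n, B (n+1) = b * B n := fun _ => rfl
  clear_value A B
  have eA : ∀ n, e * A n = A n := by
    intro n; induction n with
    | zero => rw [A0, hee]
    | succ n ih => rw [As, ← mul_assoc, ih]
  have Be : ∀ n, B n * e = B n := by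
    intro n; induction n with
    | zero => rw [B0, hee]
    | succ n ih => rw [Bs, mul_assoc, ih]
  have Ae : ∀ n, A n * e = A n := by
    intro n; cases n with
    | zero => rw [A0, hee]
    | succ n => rw [As, mul_assoc, hae]
  have eB : ∀ n, e * B n = B n := by
    intro n; cases n with
    | zero => rw [B0, hee]
    | succ n => rw [Bs, ← mul_assoc, heb]
  have AB : ∀ n, A n * B n = e := by
    intro n; induction n with
    | zero => rw [A0, B0, hee]
    | succ n ih => rw [As, Bs, mul_assoc, ← mul_assoc a, hab, eB, ih]
  have iB : ∀ n, inv (B n) = A n := by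
    intro n
    apply inv_unique_aux inv hinv1 hinv2 hidem
    · rw [mul_assoc, AB, Be]
    · rw [AB, eA]
  let G : ℕ → S := fun n => B n * A n
  have Gd : ∀ n, G n = B n * A n := fun _ => rfl
  have Gs : ∀ n, G (n+1) = b * G n * a := by
    intro n; simp only [Gd, As, Bs, mul_assoc]
  have G0 : G 0 = e := by rw [Gd, A0, B0, hee]
  have Ge : ∀ n, G n * e = G n := by intro n; rw [Gd, mul_assoc, Ae]
  clear_value G
  have dec1 : ∀ n, G (n+1) * G n = G (n+1) := by
    intro n; induction n with
    | zero => rw [G0, Ge]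
    | succ n ih =>
      have : b * G (n+1) * a * (b * G n * a) = b * G (n+1) * a := by
        calc b * G (n+1) * a * (b * G n * a) = b * (G (n+1) * (a * b) * G n) * a := by
              simp only [mul_assoc]
          _ = _ := by rw [hab, Ge, ih]
      rwa [← Gs n, ← Gs (n+1)] at this
  have dec : ∀ m n, m ≤ n → G n * G m = G n := by
    intro m n h
    induction n, h using Nat.le_induction with
    | base => rw [Gd, mul_assoc, ← mul_assoc (A m), AB, eA]
    | succ n h ih => rw [← dec1 n, mul_assoc, ih]
  obtain ⟨c, F, hF, hle, hc⟩ := cc_cluster hcc B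
  have hcA : Tendsto A F (𝓝 (inv c)) := by
    have := (hinvc.tendsto c).comp hc
    exact this.congr iB
  have hce : inv c * c = e :=
    tendsto_nhds_unique ((T hcA hc).congr AB) tendsto_const_nhds
  obtain ⟨g, hg⟩ : ∃ g, g = c * inv c := ⟨_, rfl⟩
  have gg : g * g = g := by rw [hg, ← mul_assoc, hinv1]
  have hG : Tendsto G F (𝓝 g) := by
    rw [hg]; exact (T hc hcA).congr (fun n => (Gd n).symm)
  have gG : ∀ m, g * G m = g := by
    intro m
    refine tendsto_nhds_unique (T hG tendsto_const_nhds) (hG.congr' ?_)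
    filter_upwards [hle (eventually_ge_atTop m)] with n hn
    rw [dec m n hn]
  have hG1 : Tendsto (fun n => G (n+1)) F (𝓝 (b * g * a)) :=
    (T (T tendsto_const_nhds hG) tendsto_const_nhds).congr (fun n => (Gs n).symm)
  have hGm : ∀ m, (b * g * a) * G m = b * g * a := by
    intro m
    refine tendsto_nhds_unique (T hG1 tendsto_const_nhds) (hG1.congr' ?_)
    filter_upwards [hle (eventually_ge_atTop m)] with n hn
    rw [dec m (n+1) (by omega)]
  have q1 : (b * g * a) * g = b * g * a :=
    tendsto_nhds_unique ((T tendsto_const_nhds hG).congr hGm) tendsto_const_nhds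
  have q2 : g * (b * g * a) = g :=
    tendsto_nhds_unique ((T tendsto_const_nhds hG1).congr (fun n => gG (n+1))) tendsto_const_nhds
  have ge : g * e = g := by rw [← G0, gG]
  have eg : e * g = g := by
    rw [hidem e g hee gg, ge]
  have hh : (b * g * a) * (b * g * a) = b * g * a := by
    calc (b * g * a) * (b * g * a) = b * (g * (a * b) * g) * a := by simp only [mul_assoc]
      _ = _ := by rw [hab, ge, gg]
  have hgeq : b * g * a = g := by rw [← q1, hidem _ _ hh gg, q2]
  have agb : a * g * b = g := by
    calc a * g * b = a * (b * g * a) * b := by rw [hgeq]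
      _ = (a * b) * g * (a * b) := by simp only [mul_assoc]
      _ = g := by rw [hab, eg, ge]
  have AgB : ∀ n, A n * g * B n = g := by
    intro n; induction n with
    | zero => rw [A0, B0, eg, ge]
    | succ n ih =>
      calc A (n+1) * g * B (n+1) = A n * (a * g * b) * B n := by
            rw [As, Bs]; simp only [mul_assoc]
        _ = g := by rw [agb, ih]
  have lim : inv c * g * c = g :=
    tendsto_nhds_unique ((T (T hcA tendsto_const_nhds) hc).congr AgB) tendsto_const_nhds
  have hge : g = e := by
    rw [← lim, hg, ← mul_assoc, hce, mul_assoc, hce, hee]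
  have := gG 1
  rw [hge, Gs 0, G0, hbe, ← mul_assoc, heb] at this
  exact this

/-- In a 0-simple countably compact topological inverse semigroup, the zero is an
isolated point. -/
theorem zero_isolated_of_zero_simple_countably_compact
    {S : Type*} [Semigroup S] [TopologicalSpace S] [T2Space S]
    (inv : S → S)
    (hinv1 : ∀ a : S, a * inv a * a = a)
    (hinv2 : ∀ a : S, inv a * a * inv a = inv a)
    (hidem : ∀ e f : S, e * e = e → f * f = f → e * f = f * e)
    (hmulc : Continuous fun p : S × S => p.1 * p.2)
    (hinvc : Continuous inv)
    (hcc : CountablyCompact S)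
    (z : S) (hz : ∀ x : S, z * x = z ∧ x * z = z)
    (hSS : ∃ a b : S, a * b ≠ z)
    (hideal : ∀ I : Set S, I.Nonempty →
      (∀ i ∈ I, ∀ s : S, s * i ∈ I ∧ i * s ∈ I) → I = {z} ∨ I = Set.univ) :
    IsOpen ({z} : Set S) := by
  have T : ∀ {F : Filter ℕ} {u v : ℕ → S} {x y : S}, Tendsto u F (𝓝 x) → Tendsto v F (𝓝 y) →
      Tendsto (fun n => u n * v n) F (𝓝 (x * y)) := by
    intro F u v x y hu hv
    exact (hmulc.tendsto (x, y)).comp (hu.prodMk_nhds hv)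
  have idl : ∀ a, (a * inv a) * (a * inv a) = a * inv a := by
    intro a; rw [← mul_assoc, hinv1]
  have idr : ∀ a, (inv a * a) * (inv a * a) = inv a * a := by
    intro a; rw [← mul_assoc, hinv2]
  -- translation between nonzero idempotents
  have key : ∀ e f : S, e * e = e → f * f = f → f ≠ z →
      ∃ a, a * inv a = e ∧ inv a * a * f = inv a * a := by
    intro e f he hf hfz
    have hI := hideal {s | ∃ x y, s = x * f * y} ⟨f, f, f, by rw [hf, hf]⟩ (by
      rintro _ ⟨x, y, rfl⟩ s
      exact ⟨⟨s * x, y, by simp only [mul_assoc]⟩, ⟨x, y * s, by simp only [mul_assoc]⟩⟩)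
    rcases hI with hI | hI
    · exfalso
      have : f ∈ {s | ∃ x y, s = x * f * y} := ⟨f, f, by rw [hf, hf]⟩
      rw [hI] at this
      exact hfz this
    · have : e ∈ {s | ∃ x y, s = x * f * y} := by rw [hI]; trivial
      obtain ⟨x, y, hxy⟩ := this
      obtain ⟨a, ha⟩ : ∃ a, a = e * x * f := ⟨_, rfl⟩
      have haf : a * f = a := by rw [ha, mul_assoc, hf]
      have hea : e * a = a := by rw [ha, ← mul_assoc, ← mul_assoc, he]
      have hay : a * (y * e) = e := by
        calc a * (y * e) = e * (x * f * y) * e := by rw [ha]; simp only [mul_assoc]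
          _ = e := by rw [← hxy, he, he]
      refine ⟨a, ?_, by rw [mul_assoc, haf]⟩
      have h1 : a * inv a * e = e := by
        calc a * inv a * e = a * inv a * (a * (y * e)) := by rw [hay]
          _ = e := by rw [← mul_assoc, hinv1, hay]
      have h2 : e * (a * inv a) = a * inv a := by rw [← mul_assoc, hea]
      rw [← h2, hidem _ _ he (idl a), h1]
  have prim : ∀ e f : S, e * e = e → f * f = f → f ≠ z → e * f = f → f = e := by
    intro e f he hf hfz hef
    obtain ⟨a, h1, h2⟩ := key e f he hf hfz
    have hfe : f * e = f := by rw [← hidem e f he hf, hef]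
    have h3 : inv a * a * e = inv a * a := by
      rw [← h2, mul_assoc, hfe]
    have hae : a * e = a := by
      calc a * e = a * (inv a * a * e) := by
            rw [← mul_assoc, ← mul_assoc, hinv1]
        _ = a := by rw [h3, ← mul_assoc, hinv1]
    have h4 : e * (inv a * a) = inv a * a := by
      rw [hidem _ _ he (idr a), h3]
    have heb : e * inv a = inv a := by
      calc e * inv a = e * (inv a * a) * inv a := by
            rw [mul_assoc, hinv2]
        _ = inv a := by rw [h4, hinv2]
    have h5 := no_bicyclic inv hinv1 hinv2 hidem hmulc hinvc hcc a (inv a) e h1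
      (by rw [← h1, hinv1]) hae heb (by rw [← h1, ← mul_assoc, hinv2]) he
    rw [h5, hef] at h2
    exact h2
  have orth : ∀ e f : S, e * e = e → f * f = f → e ≠ f → e * f = z := by
    intro e f he hf hne
    by_contra hz'
    have hc := hidem e f he hf
    have hi : (e * f) * (e * f) = e * f := by
      rw [mul_assoc, ← mul_assoc f, ← hc, mul_assoc e f f, hf, ← mul_assoc, he]
    have h1 := prim e (e * f) he hi hz' (by rw [← mul_assoc, he])
    have h2 := prim f (e * f) hf hi hz' (by rw [hc, ← mul_assoc, hf])
    exact hne (h1.symm.trans h2)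
  have zz : z * z = z := (hz z).1
  have fin : {e : S | e * e = e ∧ e ≠ z}.Finite := by
    by_contra hinf
    have hinf : {e : S | e * e = e ∧ e ≠ z}.Infinite := hinf
    obtain ⟨ι⟩ : Nonempty (ℕ ↪ {e : S | e * e = e ∧ e ≠ z}) := ⟨hinf.natEmbedding⟩
    have h0 := fun n => (ι n).2
    have key' : ∀ n, ∃ a, a * inv a = (ι 0 : S) ∧ inv a * a = (ι n : S) := by
      intro n
      obtain ⟨a, h1, h2⟩ := key (ι 0) (ι n) (h0 0).1 (h0 n).1 (h0 n).2
      refine ⟨a, h1, prim _ _ (h0 n).1 (idr a) ?_ ?_⟩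
      · intro hzz
        apply (h0 0).2
        rw [← h1, ← hinv1 a, mul_assoc a, hzz, (hz a).2, (hz _).1]
      · rw [hidem _ _ (h0 n).1 (idr a), h2]
    choose u hu1 hu2 using key'
    obtain ⟨c, F, hF, hle, hc⟩ := cc_cluster hcc u
    have hci : Tendsto (fun n => inv (u n)) F (𝓝 (inv c)) := (hinvc.tendsto c).comp hc
    have e0 : c * inv c = (ι 0 : S) :=
      tendsto_nhds_unique ((T hc hci).congr hu1) tendsto_const_nhds
    have hp : Tendsto (fun n => (ι n : S)) F (𝓝 (inv c * c)) := (T hci hc).congr hu2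
    have hpm : ∀ m, (inv c * c) * (ι m : S) = z := by
      intro m
      refine tendsto_nhds_unique (T hp tendsto_const_nhds) (tendsto_const_nhds.congr' ?_)
      filter_upwards [hle (eventually_gt_atTop m)] with n hn
      refine (orth _ _ (h0 n).1 (h0 m).1 ?_).symm
      intro h
      have := ι.injective (Subtype.ext h)
      omega
    have hpp : (inv c * c) * (inv c * c) = z :=
      tendsto_nhds_unique ((T tendsto_const_nhds hp).congr hpm) tendsto_const_nhds
    rw [idr] at hpp
    apply (h0 0).2
    rw [← e0, ← hinv1 c, mul_assoc c, hpp, (hz c).2, (hz _).1]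
  have hcont : Continuous fun x : S => x * inv x := hmulc.comp (continuous_id.prodMk hinvc)
  have heq : ({z} : Set S) = (fun x : S => x * inv x) ⁻¹' {e : S | e * e = e ∧ e ≠ z}ᶜ := by
    ext x
    simp only [Set.mem_singleton_iff, Set.mem_preimage, Set.mem_compl_iff, Set.mem_ofPred_eq,
      not_and, not_not, idl, true_imp_iff]
    constructor
    · rintro rfl; exact (hz _).1
    · intro h; rw [← hinv1 x, h, (hz x).1]
  rw [heq]
  exact fin.isClosed.isOpen_compl.preimage hcont
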